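/- arXiv:1402.6271 — 16 statements merged into one kernel-verified Lean document; each statement's English description precedes it below -/
import Mathlib

section
/- Let R be a ring, e an idempotent in R, and a ∈ eRe. If a is unit regular in the corner ring eRe, then a is unit regular in R. -/
/-- A unit `w` of the corner ring `eRe` extends to the unit `w + (1 - e)` of `R`. -/
def unitOfCorner {R : Type*} [Ring R] {e w y : R} (he : e * e = e)
    (hew : e * w = w) (hwe : w * e = w) (hey : e * y = y) (hye : y * e = y)
    (hwy : w * y = e) (hyw : y * w = e) : Rˣ where
  val := w + (1 - e)
  inv := y + (1 - e)
  val_inv := by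
    simp only [mul_add, add_mul, mul_sub, sub_mul, mul_one, one_mul, he, hwe, hey, hwy]
    abel
  inv_val := by
    simp only [mul_add, add_mul, mul_sub, sub_mul, mul_one, one_mul, he, hew, hye, hyw]
    abel

theorem mul_eq_self_of_mem_corner {R : Type*} [Semigroup R] {e x : R} (he : e * e = e)
    (hx : x = e * x * e) : e * x = x ∧ x * e = x := by
  constructor
  · rw [hx, ← mul_assoc, ← mul_assoc, he]
  · rw [hx, mul_assoc, he]

/-- If `a ∈ eRe` is unit regular in the corner ring `eRe`, then `a` is unit regular in `R`. -/
theorem unitRegular_corner_imp_unitRegular {R : Type*} [Ring R] (e a : R)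
    (he : e * e = e) (ha : a = e * a * e)
    (h : ∃ w : R, w = e * w * e ∧
        (∃ y : R, y = e * y * e ∧ w * y = e ∧ y * w = e) ∧ a = a * w * a) :
    ∃ u : Rˣ, a = a * u * a := by
  obtain ⟨w, hw, ⟨y, hy, hwy, hyw⟩, haw⟩ := h
  obtain ⟨hew, hwe⟩ := mul_eq_self_of_mem_corner he hw
  obtain ⟨hey, hye⟩ := mul_eq_self_of_mem_corner he hy
  obtain ⟨-, hae⟩ := mul_eq_self_of_mem_corner he ha
  refine ⟨unitOfCorner he hew hwe hey hye hwy hyw, ?_⟩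
  change a = a * (w + (1 - e)) * a
  rw [mul_add, mul_sub, mul_one, hae, sub_self, add_zero]
  exact haw
end

section
/- Let R be a ring, e an idempotent in R, f = 1 − e, and a ∈ eRe. If a is unit regular in the corner ring eRe and b ∈ fRf is unit regular in the corner ring fRf, then a + b is unit regular in R. -/
/-- Elements of the corners of two orthogonal idempotents multiply to zero. -/
theorem corner_mul_corner_eq_zero {R : Type*} [Semiring R] {g h x y : R}
    (hgh : g * h = 0) (hx : x = g * x * g) (hy : y = h * y * h) : x * y = 0 := by
  calc x * y = g * x * g * (h * y * h) := by rw [← hx, ← hy]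
    _ = g * x * (g * h) * y * h := by simp only [mul_assoc]
    _ = 0 := by simp [hgh]

/-- If `a ∈ eRe` is unit regular in `eRe` and `b ∈ fRf` is unit regular in `fRf`
(where `f = 1 - e`), then `a + b` is unit regular in `R`. -/
theorem unitRegular_add_of_corner_unitRegular {R : Type*} [Ring R] (e f a b : R)
    (he : e * e = e) (hf : f = 1 - e)
    (ha : a = e * a * e) (hb : b = f * b * f)
    (hA : ∃ w : R, w = e * w * e ∧
        (∃ y : R, y = e * y * e ∧ w * y = e ∧ y * w = e) ∧ a = a * w * a)
    (hB : ∃ w : R, w = f * w * f ∧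
        (∃ y : R, y = f * y * f ∧ w * y = f ∧ y * w = f) ∧ b = b * w * b) :
    ∃ u : Rˣ, a + b = (a + b) * u * (a + b) := by
  obtain ⟨w, hw, ⟨y, hy, hwy, hyw⟩, haw⟩ := hA
  obtain ⟨v, hv, ⟨z, hz, hvz, hzv⟩, hbv⟩ := hB
  have hef : e * f = 0 := by rw [hf, mul_sub, mul_one, he, sub_self]
  have hfe : f * e = 0 := by rw [hf, sub_mul, one_mul, he, sub_self]
  have hsum : e + f = 1 := by rw [hf, add_sub_cancel]
  refine ⟨⟨w + v, y + z, ?_, ?_⟩, ?_⟩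
  · rw [add_mul, mul_add, mul_add, hwy, hvz, corner_mul_corner_eq_zero hef hw hz,
      corner_mul_corner_eq_zero hfe hv hy, add_zero, zero_add, hsum]
  · rw [add_mul, mul_add, mul_add, hyw, hzv, corner_mul_corner_eq_zero hef hy hv,
      corner_mul_corner_eq_zero hfe hz hw, add_zero, zero_add, hsum]
  · have hav := corner_mul_corner_eq_zero hef ha hv
    have hbw := corner_mul_corner_eq_zero hfe hb hw
    have hwb := corner_mul_corner_eq_zero hef hw hb
    have hva := corner_mul_corner_eq_zero hfe hv ha
    simp only [add_mul, mul_add, hav, hbw, mul_assoc, hwb, hva, mul_zero, add_zero, zero_add]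
    rw [← mul_assoc, ← haw, ← mul_assoc, ← hbv]
end

section
/- Let R be a ring, e an idempotent in R, f = 1 − e, and a ∈ eRe. If a is unit regular in the corner ring eRe, then a + f is unit regular in R. -/
theorem IsIdempotentElem.mul_eq_self_of_eq_mul_mul {R : Type*} [Semigroup R] {e x : R}
    (he : IsIdempotentElem e) (hx : x = e * x * e) : e * x = x ∧ x * e = x := by
  constructor
  · rw [hx, ← mul_assoc, ← mul_assoc, he.eq]
  · rw [hx, mul_assoc, he.eq]

theorem IsIdempotentElem.add_one_sub_mul_add_one_sub {R : Type*} [Ring R] {e x y : R}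
    (he : IsIdempotentElem e) (hx : x * e = x) (hy : e * y = y) :
    (x + (1 - e)) * (y + (1 - e)) = x * y + (1 - e) := by
  have hxf : x * (1 - e) = 0 := by rw [mul_sub, mul_one, hx, sub_self]
  have hfy : (1 - e) * y = 0 := by rw [sub_mul, one_mul, hy, sub_self]
  rw [add_mul, mul_add, mul_add, hxf, hfy, he.one_sub.eq, add_zero, zero_add]

/-- If `a ∈ eRe` is unit regular in `eRe`, then `a + f` is unit regular in `R`,
where `f = 1 - e`. -/
theorem unitRegular_add_f_of_corner_unitRegular {R : Type*} [Ring R] (e f a : R)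
    (he : e * e = e) (hf : f = 1 - e) (ha : a = e * a * e)
    (h : ∃ w : R, w = e * w * e ∧
        (∃ y : R, y = e * y * e ∧ w * y = e ∧ y * w = e) ∧ a = a * w * a) :
    ∃ u : Rˣ, a + f = (a + f) * u * (a + f) := by
  obtain ⟨w, hw, ⟨y, hy, hwy, hyw⟩, haw⟩ := h
  have he' : IsIdempotentElem e := he
  obtain ⟨hea, hae⟩ := he'.mul_eq_self_of_eq_mul_mul ha
  obtain ⟨hew, hwe⟩ := he'.mul_eq_self_of_eq_mul_mul hw
  obtain ⟨hey, hye⟩ := he'.mul_eq_self_of_eq_mul_mul hy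
  subst hf
  refine ⟨⟨w + (1 - e), y + (1 - e), ?_, ?_⟩, ?_⟩
  · rw [he'.add_one_sub_mul_add_one_sub hwe hey, hwy, add_sub_cancel]
  · rw [he'.add_one_sub_mul_add_one_sub hye hew, hyw, add_sub_cancel]
  · have hawe : a * w * e = a * w := by rw [mul_assoc, hwe]
    rw [Units.val_mk, he'.add_one_sub_mul_add_one_sub hae hew,
      he'.add_one_sub_mul_add_one_sub hawe hea, ← haw]
end

section
/- Let R be a ring, e an idempotent in R, f = 1 − e, and a ∈ eRe. If a + f is unit regular in R, then a is unit regular in the corner ring eRe. -/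
/-- If `a + f` is unit regular in `R` (with `f = 1 - e`), then `a ∈ eRe` is unit regular
in the corner ring `eRe`. -/
theorem corner_unitRegular_of_unitRegular_add_f {R : Type*} [Ring R] (e f a : R)
    (he : e * e = e) (hf : f = 1 - e) (ha : a = e * a * e)
    (h : ∃ u : Rˣ, a + f = (a + f) * u * (a + f)) :
    ∃ w : R, w = e * w * e ∧
      (∃ y : R, y = e * y * e ∧ w * y = e ∧ y * w = e) ∧ a = a * w * a := by
  obtain ⟨u, hu⟩ := h
  have hef : e * f = 0 := by rw [hf, mul_sub, he, mul_one, sub_self]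
  have hfe : f * e = 0 := by rw [hf, sub_mul, he, one_mul, sub_self]
  have hff : f * f = f := by
    nth_rw 1 [hf]
    rw [sub_mul, hef, one_mul, sub_zero]
  have haf : a * f = 0 := by rw [ha, mul_assoc, hef, mul_zero]
  have hfa : f * a = 0 := by rw [ha, ← mul_assoc, ← mul_assoc, hfe, zero_mul, zero_mul]
  have hea : e * a = a := by rw [ha, ← mul_assoc, ← mul_assoc, he]
  have hae : a * e = a := by rw [ha, mul_assoc, he]
  have hxe : (a + f) * e = a := by rw [add_mul, hae, hfe, add_zero]
  have hex : e * (a + f) = a := by rw [mul_add, hea, hef, add_zero]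
  have hxf : (a + f) * f = f := by rw [add_mul, haf, hff, zero_add]
  have hfx : f * (a + f) = f := by rw [mul_add, hfa, hff, zero_add]
  have hfuf : f * u * f = f := by
    have := congrArg (fun x => f * x * f) hu
    rwa [← mul_assoc, ← mul_assoc, hfx, mul_assoc, mul_assoc, hxf, hff, ← mul_assoc, eq_comm]
      at this
  have haua : a * u * a = a := by
    have := congrArg (fun x => e * x * e) hu
    rwa [← mul_assoc, ← mul_assoc, hex, mul_assoc, mul_assoc, hxe, hae, ← mul_assoc, eq_comm]
      at this
  have hauf : a * u * f = 0 := by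
    have := congrArg (fun x => e * x * f) hu
    rwa [← mul_assoc, ← mul_assoc, hex, mul_assoc, mul_assoc, hxf, haf, ← mul_assoc, eq_comm]
      at this
  -- The Schur complement of the lower-right Peirce component `f * u * f = f` of `u`.
  let w : R := u - u * f * u
  have hwf : w * f = 0 := by
    simp only [w, sub_mul, mul_assoc] at hfuf ⊢
    rw [hfuf, sub_self]
  have hfw : f * w = 0 := by
    simp only [w, mul_sub, ← mul_assoc]
    rw [hfuf, sub_self]
  have he' : e = 1 - f := by rw [hf, sub_sub_cancel]
  have hwe : w * e = w := by rw [he', mul_sub, hwf, mul_one, sub_zero]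
  have hew : e * w = w := by rw [he', sub_mul, hfw, one_mul, sub_zero]
  have hwv : w * ↑u⁻¹ = 1 - u * f := by simp [w, sub_mul]
  have hvw : ↑u⁻¹ * w = 1 - f * u := by simp [w, mul_sub, mul_assoc]
  refine ⟨w, by rw [hew, hwe], ⟨e * ↑u⁻¹ * e, ?_, ?_, ?_⟩, ?_⟩
  · simp only [← mul_assoc, he]
    rw [mul_assoc _ e e, he]
  · rw [← mul_assoc, ← mul_assoc, hwe, hwv, sub_mul, one_mul, mul_assoc, hfe, mul_zero, sub_zero]
  · rw [mul_assoc, hew, mul_assoc, hvw, mul_sub, mul_one, ← mul_assoc, hef, zero_mul, sub_zero]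
  · simp only [w, mul_sub, ← mul_assoc, hauf, zero_mul, sub_zero, haua]
end

section
/- Let R be a ring, e an idempotent in R, f = 1 − e, and a ∈ eRe. Then a is unit regular in the corner ring eRe if and only if a + f is unit regular in R. -/
/-- In the corner `eRe`, an element `a` with inner inverse `x` is unit regular as soon as the
complementary idempotents `e - x * a` and `e - a * x` are equivalent via `s` and `t`. -/
theorem corner_unitRegular_of_equiv_complements {R : Type*} [Ring R] {e a x s t : R}
    (he : e * e = e) (hea : e * a = a) (hae : a * e = a) (hex : e * x = x) (hxe : x * e = x)
    (haxa : a * x * a = a)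
    (hps : (e - x * a) * s = s) (hsq : s * (e - a * x) = s)
    (hqt : (e - a * x) * t = t) (htp : t * (e - x * a) = t)
    (hst : s * t = e - x * a) (hts : t * s = e - a * x) :
    ∃ w : R, w = e * w * e ∧
      (∃ y : R, y = e * y * e ∧ w * y = e ∧ y * w = e) ∧ a = a * w * a := by
  have hap : a * (e - x * a) = 0 := by rw [mul_sub, hae, ← mul_assoc, haxa, sub_self]
  have hqa : (e - a * x) * a = 0 := by rw [sub_mul, hea, haxa, sub_self]
  have has : a * s = 0 := by rw [← hps, ← mul_assoc, hap, zero_mul]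
  have hsa : s * a = 0 := by rw [← hsq, mul_assoc, hqa, mul_zero]
  have hep : e * (e - x * a) = e - x * a := by rw [mul_sub, he, ← mul_assoc, hex]
  have hpe : (e - x * a) * e = e - x * a := by rw [sub_mul, he, mul_assoc, hae]
  have heq : e * (e - a * x) = e - a * x := by rw [mul_sub, he, ← mul_assoc, hea]
  have hqe : (e - a * x) * e = e - a * x := by rw [sub_mul, he, mul_assoc, hxe]
  have hes : e * s = s := by rw [← hps, ← mul_assoc, hep]
  have hse : s * e = s := by rw [← hsq, mul_assoc, hqe]
  have het : e * t = t := by rw [← hqt, ← mul_assoc, heq]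
  have hte : t * e = t := by rw [← htp, mul_assoc, hpe]
  have haxt : a * x * t = 0 := by
    rw [sub_mul, het] at hqt
    exact sub_eq_self.mp hqt
  have htxa : t * x * a = 0 := by
    rw [mul_sub, hte, ← mul_assoc] at htp
    exact sub_eq_self.mp htp
  refine ⟨x * a * x + s, ?_, ⟨a + t, ?_, ?_, ?_⟩, ?_⟩
  · rw [mul_add, add_mul, hes, hse, mul_assoc e, mul_assoc (x * a), hxe, ← mul_assoc e,
      ← mul_assoc e, hex]
  · rw [mul_add, add_mul, hea, hae, het, hte]
  · calc (x * a * x + s) * (a + t)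
        = x * (a * x * a) + x * (a * x * t) + s * a + s * t := by noncomm_ring
      _ = e := by rw [haxa, haxt, hsa, hst]; noncomm_ring
  · calc (a + t) * (x * a * x + s)
        = a * x * a * x + t * x * a * x + a * s + t * s := by noncomm_ring
      _ = e := by rw [haxa, htxa, has, hts]; noncomm_ring
  · calc a = a * x * a := haxa.symm
      _ = a * x * a * x * a + a * s * a := by rw [haxa, has, haxa, zero_mul, add_zero]
      _ = a * (x * a * x + s) * a := by noncomm_ring

/-- `a ∈ eRe` is unit regular in the corner ring `eRe` iff `a + f` is unit regular in `R`,
where `f = 1 - e`. -/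
theorem corner_unitRegular_iff_unitRegular_add_f {R : Type*} [Ring R] (e f a : R)
    (he : e * e = e) (hf : f = 1 - e) (ha : a = e * a * e) :
    (∃ w : R, w = e * w * e ∧
        (∃ y : R, y = e * y * e ∧ w * y = e ∧ y * w = e) ∧ a = a * w * a) ↔
      (∃ u : Rˣ, a + f = (a + f) * u * (a + f)) := by
  have left_e {z : R} (hz : z = e * z * e) : e * z = z := by
    rw [hz, ← mul_assoc, ← mul_assoc, he]
  have right_e {z : R} (hz : z = e * z * e) : z * e = z := by
    rw [hz, mul_assoc, he]
  have left_f {z : R} (hz : z = e * z * e) : f * z = 0 := by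
    rw [hf, sub_mul, one_mul, left_e hz, sub_self]
  have right_f {z : R} (hz : z = e * z * e) : z * f = 0 := by
    rw [hf, mul_sub, mul_one, right_e hz, sub_self]
  have hff : f * f = f := by
    rw [hf, sub_mul, mul_sub, mul_sub, he]; noncomm_ring
  have hef : e * f = 0 := by rw [hf, mul_sub, mul_one, he, sub_self]
  have hfe : f * e = 0 := by rw [hf, sub_mul, one_mul, he, sub_self]
  have add_f_mul {z z' : R} (hz : z = e * z * e) (hz' : z' = e * z' * e) :
      (z + f) * (z' + f) = z * z' + f := by
    rw [add_mul, mul_add, mul_add, right_f hz, left_f hz', hff, add_zero, zero_add]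
  constructor
  · rintro ⟨w, hw, ⟨y, hy, hwy, hyw⟩, hawa⟩
    have hsum : e + f = 1 := by rw [hf]; abel
    refine ⟨⟨w + f, y + f, ?_, ?_⟩, ?_⟩
    · rw [add_f_mul hw hy, hwy, hsum]
    · rw [add_f_mul hy hw, hyw, hsum]
    · have haw : a * w = e * (a * w) * e := by
        rw [← mul_assoc, left_e ha, mul_assoc, right_e hw]
      change a + f = (a + f) * (w + f) * (a + f)
      rw [add_f_mul ha hw, add_f_mul haw ha, ← hawa]
  · rintro ⟨u, hu⟩
    have hea := left_e ha
    have hae := right_e ha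
    obtain ⟨b, hb⟩ : ∃ b, b = a + f := ⟨_, rfl⟩
    rw [← hb] at hu
    have heb : e * b = a := by rw [hb, mul_add, hea, hef, add_zero]
    have hbe : b * e = a := by rw [hb, add_mul, hae, hfe, add_zero]
    have hfb : f * b = f := by rw [hb, mul_add, left_f ha, hff, zero_add]
    have hbf : b * f = f := by rw [hb, add_mul, right_f ha, hff, zero_add]
    obtain ⟨x, hx⟩ : ∃ x : R, x = e * u * e := ⟨_, rfl⟩
    have hex : e * x = x := by rw [hx, ← mul_assoc, ← mul_assoc, he]
    have hxe : x * e = x := by rw [hx, mul_assoc, he]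
    have haxa : a * x * a = a := by
      calc a * x * a = (a * e) * u * (e * a) := by rw [hx]; noncomm_ring
        _ = e * (b * u * b) * e := by
          rw [hae, hea]; nth_rw 1 [← heb]; rw [← hbe]; noncomm_ring
        _ = a := by rw [← hu, heb, hae]
    have hbP : b * (1 - u * b) = 0 := by
      rw [mul_sub, mul_one, ← mul_assoc, ← hu, sub_self]
    have hQb : (1 - b * u) * b = 0 := by rw [sub_mul, one_mul, ← hu, sub_self]
    have hbp : b * (e - x * a) = 0 := by
      rw [mul_sub, hbe, ← hex, ← mul_assoc, ← mul_assoc, hbe, haxa, sub_self]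
    have hqb : (e - a * x) * b = 0 := by
      rw [sub_mul, heb, ← hxe, mul_assoc, mul_assoc, heb, ← mul_assoc, haxa, sub_self]
    have heP : e * (1 - u * b) = 1 - u * b := by
      have hfP : f * (1 - u * b) = 0 := by rw [← hfb, mul_assoc, hbP, mul_zero]
      rw [hf, sub_mul, one_mul] at hfP
      exact (sub_eq_zero.mp hfP).symm
    have hQe : (1 - b * u) * e = 1 - b * u := by
      have hQf : (1 - b * u) * f = 0 := by rw [← hbf, ← mul_assoc, hQb, zero_mul]
      rw [hf, mul_sub, mul_one] at hQf
      exact (sub_eq_zero.mp hQf).symm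
    have hpP : (e - x * a) * (1 - u * b) = 1 - u * b := by
      rw [sub_mul, heP, ← heb, mul_assoc, mul_assoc, hbP, mul_zero, mul_zero, sub_zero]
    have hPp : (1 - u * b) * (e - x * a) = e - x * a := by
      rw [sub_mul, one_mul, mul_assoc, hbp, mul_zero, sub_zero]
    have hQq : (1 - b * u) * (e - a * x) = 1 - b * u := by
      rw [mul_sub, hQe, ← hbe, ← mul_assoc, ← mul_assoc, hQb, zero_mul, zero_mul, sub_zero]
    have hqQ : (e - a * x) * (1 - b * u) = e - a * x := by
      rw [mul_sub, mul_one, ← mul_assoc, hqb, zero_mul, sub_zero]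
    have hpp : (e - x * a) * (e - x * a) = e - x * a := by
      nth_rw 2 [← hPp]; rw [← mul_assoc, hpP, hPp]
    have hqq : (e - a * x) * (e - a * x) = e - a * x := by
      nth_rw 1 [← hqQ]; rw [mul_assoc, hQq, hqQ]
    have hPu : (1 - u * b) * u = u * (1 - b * u) := by noncomm_ring
    refine corner_unitRegular_of_equiv_complements (s := (1 - u * b) * u)
      (t := (e - a * x) * ↑u⁻¹ * (e - x * a)) he hea hae hex hxe haxa ?_ ?_ ?_ ?_ ?_ ?_
    · rw [← mul_assoc, hpP]
    · rw [hPu, mul_assoc, hQq]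
    · rw [← mul_assoc, ← mul_assoc, hqq]
    · rw [mul_assoc, hpp]
    · calc (1 - u * b) * u * ((e - a * x) * ↑u⁻¹ * (e - x * a))
          = u * ((1 - b * u) * (e - a * x)) * ↑u⁻¹ * (e - x * a) := by
            rw [hPu]; simp only [mul_assoc]
        _ = e - x * a := by rw [hQq, ← hPu, Units.mul_inv_cancel_right, hPp]
    · calc (e - a * x) * ↑u⁻¹ * (e - x * a) * ((1 - u * b) * u)
          = (e - a * x) * (↑u⁻¹ * (((e - x * a) * (1 - u * b)) * u)) := by
            simp only [mul_assoc]
        _ = e - a * x := by rw [hpP, hPu, Units.inv_mul_cancel_left, hqQ]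
end

section
/- Let R be a ring, e an idempotent in R, f = 1 − e, and a ∈ eRe. If there exists a unit b of the corner ring fRf such that a + b is unit regular in R, then a is unit regular in the corner ring eRe. -/
/-- If there exists a unit `b` of the corner ring `fRf` (where `f = 1 - e`) such that `a + b`
is unit regular in `R`, then `a ∈ eRe` is unit regular in the corner ring `eRe`. -/
theorem corner_unitRegular_of_exists_unit {R : Type*} [Ring R] (e f a : R)
    (he : e * e = e) (hf : f = 1 - e) (ha : a = e * a * e)
    (h : ∃ b : R, b = f * b * f ∧ (∃ y : R, y = f * y * f ∧ b * y = f ∧ y * b = f) ∧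
        ∃ u : Rˣ, a + b = (a + b) * u * (a + b)) :
    ∃ w : R, w = e * w * e ∧
      (∃ y : R, y = e * y * e ∧ w * y = e ∧ y * w = e) ∧ a = a * w * a := by
  obtain ⟨b, hb, ⟨y, -, hby, hyb⟩, u, hu⟩ := h
  have hff : f * f = f := by simp [hf, mul_sub, sub_mul, he]
  have hef : e * f = 0 := by simp [hf, mul_sub, he]
  have hfe : f * e = 0 := by simp [hf, sub_mul, he]
  have hea : e * a = a := by rw [ha]; simp only [← mul_assoc, he]
  have hae : a * e = a := by rw [ha]; simp only [mul_assoc, he]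
  have hfb : f * b = b := by rw [hb]; simp only [← mul_assoc, hff]
  have hbf : b * f = b := by rw [hb]; simp only [mul_assoc, hff]
  have heb : e * b = 0 := by rw [← hfb, ← mul_assoc, hef, zero_mul]
  have hbe : b * e = 0 := by rw [← hbf, mul_assoc, hfe, mul_zero]
  have hfa : f * a = 0 := by rw [← hea, ← mul_assoc, hfe, zero_mul]
  have haf : a * f = 0 := by rw [← hae, mul_assoc, hef, mul_zero]
  have block (p q : R) : p * (a + b) * q = (p * a + p * b) * u * (a * q + b * q) := by
    calc p * (a + b) * q = p * ((a + b) * u * (a + b)) * q := by rw [← hu]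
      _ = _ := by noncomm_ring
  have haua : a = a * u * a := by
    simpa [mul_add, hea, heb, hae, hbe] using block e e
  have haub : a * u * b = 0 := by
    simpa [mul_add, hea, heb, haf, hbf] using (block e f).symm
  have hbub : b = b * u * b := by
    simpa [mul_add, hfa, hfb, haf, hbf] using block f f
  have hbuf : b * u * f = f := by
    rw [← hby, ← mul_assoc, ← hbub]
  have hfub : f * u * b = f := by
    calc f * u * b = y * (b * u * b) := by rw [← hyb]; noncomm_ring
      _ = f := by rw [← hbub, hyb]
  have he1 : e = 1 - f := by rw [hf]; abel
  have huv : (u : R) * (↑u⁻¹ : R) = 1 := u.mul_inv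
  have hvu : (↑u⁻¹ : R) * (u : R) = 1 := u.inv_mul
  generalize (↑u⁻¹ : R) = v at huv hvu
  generalize (u : R) = t at *
  have huev : t * e * v = 1 - t * f * v := by
    rw [he1, mul_sub, sub_mul, mul_one, huv]
  have hveu : v * e * t = 1 - v * f * t := by
    rw [he1, mul_sub, sub_mul, mul_one, hvu]
  refine ⟨e * (t - t * b * t) * e, ?_, ⟨e * v * e, ?_, ?_, ?_⟩, ?_⟩
  · simp only [mul_assoc, he]
    simp only [← mul_assoc, he]
  · simp only [mul_assoc, he]
    simp only [← mul_assoc, he]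
  · calc e * (t - t * b * t) * e * (e * v * e)
        = e * (1 - t * b) * (t * (e * e) * v) * e := by noncomm_ring
      _ = e * 1 * e - e * t * f * v * e - e * t * (b * e) + e * t * (b * t * f) * v * e := by
        rw [he, huev]; noncomm_ring
      _ = e := by rw [hbuf, hbe, mul_one, he]; noncomm_ring
  · calc e * v * e * (e * (t - t * b * t) * e)
        = e * (v * (e * e) * t) * (1 - b * t) * e := by noncomm_ring
      _ = e * 1 * e - e * v * f * t * e - (e * b) * t * e + e * v * (f * t * b) * t * e := by
        rw [he, hveu]; noncomm_ring
      _ = e := by rw [hfub, heb, mul_one, he]; noncomm_ring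
  · calc a = a * t * a - a * t * b * t * a := by rw [haub, ← haua]; simp
      _ = (a * e) * (t - t * b * t) * (e * a) := by rw [hae, hea]; noncomm_ring
      _ = _ := by noncomm_ring
end

section
/- Let R be a ring, e an idempotent in R, f = 1 − e, and a ∈ eRe. If there exists b ∈ fRf, which is neither a left zero-divisor nor a right zero-divisor of the corner ring fRf, such that a + b is unit regular in R, then a is unit regular in the corner ring eRe. -/
/-- If there exists `b ∈ fRf` (where `f = 1 - e`) that is neither a left nor a right
zero-divisor of the corner ring `fRf`, such that `a + b` is unit regular in `R`,
then `a ∈ eRe` is unit regular in the corner ring `eRe`. -/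
theorem corner_unitRegular_of_exists_nonZeroDivisor {R : Type*} [Ring R] (e f a : R)
    (he : e * e = e) (hf : f = 1 - e) (ha : a = e * a * e)
    (h : ∃ b : R, b = f * b * f ∧
        ¬(∃ c : R, c = f * c * f ∧ c ≠ 0 ∧ b * c = 0) ∧
        ¬(∃ c : R, c = f * c * f ∧ c ≠ 0 ∧ c * b = 0) ∧
        ∃ u : Rˣ, a + b = (a + b) * u * (a + b)) :
    ∃ w : R, w = e * w * e ∧
      (∃ y : R, y = e * y * e ∧ w * y = e ∧ y * w = e) ∧ a = a * w * a := by
  obtain ⟨b, hb, hl, hr, u, hu⟩ := h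
  have hef : e * f = 0 := by rw [hf, mul_sub, he, mul_one, sub_self]
  have hfe : f * e = 0 := by rw [hf, sub_mul, he, one_mul, sub_self]
  have hff : f * f = f := by
    nth_rewrite 1 [hf]
    rw [sub_mul, hef, one_mul, sub_zero]
  have hea : e * a = a := by rw [ha]; simp only [← mul_assoc, he]
  have hae : a * e = a := by rw [ha]; simp only [mul_assoc, he]
  have hfb : f * b = b := by rw [hb]; simp only [← mul_assoc, hff]
  have hbf : b * f = b := by rw [hb]; simp only [mul_assoc, hff]
  have heb : e * b = 0 := by rw [← hfb, ← mul_assoc, hef, zero_mul]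
  have hbe : b * e = 0 := by rw [← hbf, mul_assoc, hfe, mul_zero]
  have hfa : f * a = 0 := by rw [← hea, ← mul_assoc, hfe, zero_mul]
  have haf : a * f = 0 := by rw [← hae, mul_assoc, hef, mul_zero]
  have block (p q : R) : p * (a + b) * q = (p * (a + b)) * u * ((a + b) * q) := by
    conv_lhs => rw [hu]
    simp only [mul_assoc]
  have haua : a * u * a = a := by
    simpa [mul_add, add_mul, hea, hae, heb, hbe] using (block e e).symm
  have haub : a * u * b = 0 := by
    simpa [mul_add, add_mul, hea, haf, heb, hbf] using (block e f).symm
  have hbub : b * u * b = b := by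
    simpa [mul_add, add_mul, hfa, haf, hfb, hbf] using (block f f).symm
  have hfub : f * u * b = f := by
    by_contra hne
    refine hl ⟨f * u * b - f, ?_, sub_ne_zero.mpr hne, ?_⟩
    · rw [mul_sub, sub_mul, hff, hff, mul_assoc f _ f, mul_assoc _ b f, hbf,
        ← mul_assoc, ← mul_assoc, hff]
    · rw [mul_sub, ← mul_assoc, ← mul_assoc, hbf, hbub, sub_self]
  have hbuf : b * u * f = f := by
    by_contra hne
    refine hr ⟨b * u * f - f, ?_, sub_ne_zero.mpr hne, ?_⟩
    · rw [mul_sub, sub_mul, hff, hff, mul_assoc f _ f, mul_assoc _ f f, hff,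
        ← mul_assoc, ← mul_assoc, hfb]
    · rw [sub_mul, mul_assoc _ f b, hfb, hbub, sub_self]
  have he1 : e = 1 - f := by rw [hf, sub_sub_cancel]
  -- The Schur complement of the invertible block `f * u * f` of `u`.
  have hright : (u - u * b * u) * e * ↑u⁻¹ * e = e := by
    have h₁ : (u - u * b * u) * f = u * f - u * f := by
      rw [sub_mul, mul_assoc (u : R) b, mul_assoc (u : R) (b * u), hbuf]
    have h₂ : (u - u * b * u) * e = u - u * b * u := by
      rw [he1, mul_sub, mul_one, h₁, sub_self, sub_zero]
    rw [h₂, sub_mul, Units.mul_inv, Units.mul_inv_cancel_right, sub_mul, one_mul, mul_assoc,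
      hbe, mul_zero, sub_zero]
  have hleft : e * ↑u⁻¹ * e * (u - u * b * u) = e := by
    have h₂ : e * (u - u * b * u) = u - u * b * u := by
      rw [he1, sub_mul, one_mul, mul_sub, ← mul_assoc, ← mul_assoc, hfub, sub_self, sub_zero]
    rw [mul_assoc, h₂, mul_sub, Units.inv_mul_cancel_right, mul_assoc (u : R) b, ← mul_assoc,
      Units.inv_mul_cancel_right, ← mul_assoc, heb, zero_mul, sub_zero]
  refine ⟨e * (u - u * b * u) * e, ?_, ⟨e * ↑u⁻¹ * e, ?_, ?_, ?_⟩, ?_⟩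
  · simp only [mul_assoc, he]
    rw [← mul_assoc e e, he]
  · simp only [mul_assoc, he]
    rw [← mul_assoc e e, he]
  · calc e * (u - u * b * u) * e * (e * ↑u⁻¹ * e)
        = e * ((u - u * b * u) * (e * e) * ↑u⁻¹ * e) := by simp only [mul_assoc]
      _ = e := by rw [he, hright, he]
  · calc e * ↑u⁻¹ * e * (e * (u - u * b * u) * e)
        = e * ↑u⁻¹ * (e * e) * (u - u * b * u) * e := by simp only [mul_assoc]
      _ = e := by rw [he, hleft, he]
  · calc a = a * u * a - a * u * b * u * a := by rw [haub, haua]; simp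
      _ = a * (u - u * b * u) * a := by simp only [mul_sub, sub_mul, mul_assoc]
      _ = (a * e) * (u - u * b * u) * (e * a) := by rw [hae, hea]
      _ = a * (e * (u - u * b * u) * e) * a := by simp only [mul_assoc]
end

section
/- Let R be a ring, e an idempotent in R, f = 1 − e, and a ∈ eRe. The following are equivalent: (1) a is unit regular in the corner ring eRe; (2) a + f is unit regular in R; (3) a + b is unit regular in R for every unit b of the corner ring fRf; (3') a + b is unit regular in R for some unit b of the corner ring fRf; (4) a + b is unit regular in R for every b ∈ fRf that is unit regular in the corner ring fRf; (5) a + b is unit regular in R for some b ∈ fRf that is neither a left zero-divisor nor a right zero-divisor of the corner ring fRf. -/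
/-- Orthogonal idempotents `e`, `f` summing to one: the sum of a unit regular element of `eRe` and
one of `fRf` is unit regular. -/
theorem exists_units_add_eq_of_corners {R : Type*} [Ring R] {e f a b w y w' y' : R}
    (hsum : e + f = 1) (hef : e * f = 0) (hfe : f * e = 0)
    (ha : a = e * a * e) (hb : b = f * b * f)
    (hw : w = e * w * e) (hy : y = e * y * e) (hwy : w * y = e) (hyw : y * w = e)
    (hw' : w' = f * w' * f) (hy' : y' = f * y' * f) (hwy' : w' * y' = f) (hyw' : y' * w' = f)
    (haw : a = a * w * a) (hbw : b = b * w' * b) :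
    ∃ u : Rˣ, a + b = (a + b) * u * (a + b) := by
  have ortho {g k : R} (hgk : g * k = 0) {x z : R} (hx : x = g * x * g) (hz : z = k * z * k) :
      x * z = 0 := by
    rw [hx, hz]
    calc g * x * g * (k * z * k) = g * x * (g * k) * (z * k) := by noncomm_ring
      _ = 0 := by rw [hgk]; simp
  refine ⟨⟨w + w', y + y', ?_, ?_⟩, ?_⟩
  · rw [add_mul, mul_add, mul_add, ortho hef hw hy', ortho hfe hw' hy, hwy, hwy', add_zero,
      zero_add, hsum]
  · rw [add_mul, mul_add, mul_add, ortho hef hy hw', ortho hfe hy' hw, hyw, hyw', add_zero,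
      zero_add, hsum]
  · have h : (a + b) * (w + w') = a * w + b * w' := by
      rw [add_mul, mul_add, mul_add, ortho hef ha hw', ortho hfe hb hw, add_zero, zero_add]
    rw [h, add_mul, mul_add, mul_add, ← haw, ← hbw, mul_assoc a, ortho hef hw hb,
      mul_assoc b, ortho hfe hw' ha]
    simp

/-- Schur complement: if the `f`-block of a unit `u` has inverse `b` in `fRf`, then
`e * u * e - e * u * b * u * e` has right inverse the `e`-block of `u⁻¹`. -/
theorem schur_mul_inv_block {R : Type*} [Ring R] {e f b u v : R}
    (he : e * e = e) (hsum : e + f = 1)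
    (hfe : f * e = 0) (hbf : b * f = b) (huv : u * v = 1) (hbu : b * u * f = f) :
    (e * u * e - e * u * b * u * e) * (e * v * e) = e := by
  have huev : u * e * v = 1 - u * f * v := by
    rw [eq_sub_iff_add_eq, ← add_mul, ← mul_add, hsum, mul_one, huv]
  have hbe : b * e = 0 := by rw [← hbf, mul_assoc, hfe, mul_zero]
  calc (e * u * e - e * u * b * u * e) * (e * v * e)
      = e * (u * (e * e) * v) * e - e * u * b * (u * (e * e) * v) * e := by noncomm_ring
    _ = e * 1 * e - e * u * f * v * e - (e * u * (b * e) - e * u * (b * u * f) * v * e) := by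
        rw [he, huev]; noncomm_ring
    _ = e := by rw [mul_one, he, hbe, hbu]; noncomm_ring

/-- Schur complement: if the `f`-block of a unit `u` has inverse `b` in `fRf`, then
`e * u * e - e * u * b * u * e` has left inverse the `e`-block of `u⁻¹`. -/
theorem inv_block_mul_schur {R : Type*} [Ring R] {e f b u v : R}
    (he : e * e = e) (hsum : e + f = 1) (hef : e * f = 0)
    (hfb : f * b = b) (hvu : v * u = 1) (hub : f * u * b = f) :
    (e * v * e) * (e * u * e - e * u * b * u * e) = e := by
  have hveu : v * e * u = 1 - v * f * u := by
    rw [eq_sub_iff_add_eq, ← add_mul, ← mul_add, hsum, mul_one, hvu]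
  have heb : e * b = 0 := by rw [← hfb, ← mul_assoc, hef, zero_mul]
  calc (e * v * e) * (e * u * e - e * u * b * u * e)
      = e * (v * (e * e) * u) * e - e * (v * (e * e) * u) * b * u * e := by noncomm_ring
    _ = e * 1 * e - e * v * f * u * e - ((e * b) * u * e - e * v * (f * u * b) * u * e) := by
        rw [he, hveu]; noncomm_ring
    _ = e := by rw [mul_one, he, heb, hub]; noncomm_ring

/-- If `a + b` is unit regular with `a ∈ eRe` and `b` neither a left nor a right zero-divisor
of `fRf`, then `a` is unit regular in `eRe`. -/
theorem corner_unitRegular_of_add {R : Type*} [Ring R] {e f a b : R}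
    (he : e * e = e) (hff : f * f = f) (hsum : e + f = 1) (hef : e * f = 0) (hfe : f * e = 0)
    (ha : a = e * a * e) (hb : b = f * b * f)
    (hl : ¬∃ c : R, c = f * c * f ∧ c ≠ 0 ∧ b * c = 0)
    (hr : ¬∃ c : R, c = f * c * f ∧ c ≠ 0 ∧ c * b = 0)
    (u : Rˣ) (h : a + b = (a + b) * u * (a + b)) :
    ∃ w : R, w = e * w * e ∧
      (∃ y : R, y = e * y * e ∧ w * y = e ∧ y * w = e) ∧ a = a * w * a := by
  have hea : e * a = a := by rw [ha, ← mul_assoc, ← mul_assoc, he]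
  have hae : a * e = a := by rw [ha, mul_assoc, he]
  have hfb : f * b = b := by rw [hb, ← mul_assoc, ← mul_assoc, hff]
  have hbf : b * f = b := by rw [hb, mul_assoc, hff]
  have heb : e * b = 0 := by rw [← hfb, ← mul_assoc, hef, zero_mul]
  have hbe : b * e = 0 := by rw [← hbf, mul_assoc, hfe, mul_zero]
  have hfa : f * a = 0 := by rw [← hea, ← mul_assoc, hfe, zero_mul]
  have haf : a * f = 0 := by rw [← hae, mul_assoc, hef, mul_zero]
  have block (g k : R) : g * (a + b) * k = (g * (a + b)) * u * ((a + b) * k) := by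
    conv_lhs => rw [h]
    noncomm_ring
  have haa : a = a * u * a := by
    simpa only [mul_add, add_mul, hea, heb, hae, hbe, add_zero] using block e e
  have hbb : b = b * u * b := by
    simpa only [mul_add, add_mul, hfa, hfb, haf, hbf, zero_add] using block f f
  have hab : 0 = a * u * b := by
    simpa only [mul_add, add_mul, hea, heb, haf, hbf, zero_add, add_zero] using block e f
  have hub : f * u * b = f := by
    by_contra hne
    refine hl ⟨f * u * b - f, ?_, sub_ne_zero.2 hne, ?_⟩
    · calc f * u * b - f = (f * f) * u * (b * f) - f * f * f := by rw [hff, hff, hbf]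
        _ = f * (f * u * b - f) * f := by noncomm_ring
    · calc b * (f * u * b - f) = (b * f) * u * b - b * f := by noncomm_ring
        _ = 0 := by rw [hbf, ← hbb, sub_self]
  have hbu : b * u * f = f := by
    by_contra hne
    refine hr ⟨b * u * f - f, ?_, sub_ne_zero.2 hne, ?_⟩
    · calc b * u * f - f = (f * b) * u * (f * f) - f * f * f := by rw [hff, hff, hfb]
        _ = f * (b * u * f - f) * f := by noncomm_ring
    · calc (b * u * f - f) * b = b * u * (f * b) - f * b := by noncomm_ring
        _ = 0 := by rw [hfb, ← hbb, sub_self]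
  refine ⟨e * u * e - e * u * b * u * e, ?_, ⟨e * ↑u⁻¹ * e, ?_, ?_, ?_⟩, ?_⟩
  · calc e * u * e - e * u * b * u * e
        = (e * e) * u * (e * e) - (e * e) * u * b * u * (e * e) := by rw [he]
      _ = e * (e * u * e - e * u * b * u * e) * e := by noncomm_ring
  · calc e * ↑u⁻¹ * e = (e * e) * ↑u⁻¹ * (e * e) := by rw [he]
      _ = e * (e * ↑u⁻¹ * e) * e := by noncomm_ring
  · exact schur_mul_inv_block he hsum hfe hbf u.mul_inv hbu
  · exact inv_block_mul_schur he hsum hef hfb u.inv_mul hub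
  · symm
    calc a * (e * u * e - e * u * b * u * e) * a
        = (a * e) * u * (e * a) - ((a * e) * u * b) * u * (e * a) := by noncomm_ring
      _ = a := by rw [hae, hea, ← hab, ← haa]; simp


/-- The main theorem: for an idempotent `e ∈ R`, `f = 1 - e`, and `a ∈ eRe`,
the six conditions (1), (2), (3), (3'), (4), (5) are equivalent. -/
theorem corner_unitRegular_tfae {R : Type*} [Ring R] (e f a : R)
    (he : e * e = e) (hf : f = 1 - e) (ha : a = e * a * e) :
    List.TFAE
      [ -- (1) `a` is unit regular in the corner ring `eRe`
        (∃ w : R, w = e * w * e ∧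
          (∃ y : R, y = e * y * e ∧ w * y = e ∧ y * w = e) ∧ a = a * w * a),
        -- (2) `a + f` is unit regular in `R`
        (∃ u : Rˣ, a + f = (a + f) * u * (a + f)),
        -- (3) `a + b` is unit regular in `R` for every unit `b` of `fRf`
        (∀ b : R, b = f * b * f → (∃ y : R, y = f * y * f ∧ b * y = f ∧ y * b = f) →
          ∃ u : Rˣ, a + b = (a + b) * u * (a + b)),
        -- (3') `a + b` is unit regular in `R` for some unit `b` of `fRf`
        (∃ b : R, b = f * b * f ∧ (∃ y : R, y = f * y * f ∧ b * y = f ∧ y * b = f) ∧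
          ∃ u : Rˣ, a + b = (a + b) * u * (a + b)),
        -- (4) `a + b` is unit regular in `R` for every unit regular `b` of `fRf`
        (∀ b : R, b = f * b * f →
          (∃ w : R, w = f * w * f ∧
            (∃ y : R, y = f * y * f ∧ w * y = f ∧ y * w = f) ∧ b = b * w * b) →
          ∃ u : Rˣ, a + b = (a + b) * u * (a + b)),
        -- (5) `a + b` is unit regular in `R` for some `b ∈ fRf` that is neither a left
        -- nor a right zero-divisor of `fRf`
        (∃ b : R, b = f * b * f ∧
          ¬(∃ c : R, c = f * c * f ∧ c ≠ 0 ∧ b * c = 0) ∧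
          ¬(∃ c : R, c = f * c * f ∧ c ≠ 0 ∧ c * b = 0) ∧
          ∃ u : Rˣ, a + b = (a + b) * u * (a + b)) ] := by
  have hsum : e + f = 1 := by rw [hf]; abel
  have hef : e * f = 0 := by rw [hf, mul_sub, mul_one, he, sub_self]
  have hfe : f * e = 0 := by rw [hf, sub_mul, one_mul, he, sub_self]
  have hff : f * f = f := by
    calc f * f = (e + f) * f := by rw [add_mul, hef, zero_add]
      _ = f := by rw [hsum, one_mul]
  have hfff : f = f * f * f := by rw [hff, hff]
  tfae_have 1 → 5 := by
    rintro ⟨w, hw, ⟨y, hy, hwy, hyw⟩, haw⟩ b hb ⟨w', hw', ⟨y', hy', hwy', hyw'⟩, hbw⟩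
    exact exists_units_add_eq_of_corners hsum hef hfe ha hb hw hy hwy hyw hw' hy' hwy' hyw' haw hbw
  tfae_have 5 → 3 := by
    rintro h b hb ⟨y, hy, hby, hyb⟩
    refine h b hb ⟨y, hy, ⟨b, hb, hyb, hby⟩, ?_⟩
    rw [hby, hb, ← mul_assoc, ← mul_assoc, hff]
  tfae_have 3 → 2 := fun h => h f hfff ⟨f, hfff, hff, hff⟩
  tfae_have 2 → 4 := fun h => ⟨f, hfff, ⟨f, hfff, hff, hff⟩, h⟩
  tfae_have 4 → 6 := by
    rintro ⟨b, hb, ⟨y, hy, hby, hyb⟩, hu⟩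
    refine ⟨b, hb, ?_, ?_, hu⟩
    · rintro ⟨c, hc, hne, hbc⟩
      refine hne ?_
      rw [hc, ← hyb, mul_assoc y, hbc, mul_zero, zero_mul]
    · rintro ⟨c, hc, hne, hcb⟩
      refine hne ?_
      rw [hc, ← hby, mul_assoc (b * y), ← mul_assoc c, hcb, zero_mul, mul_zero]
  tfae_have 6 → 1 := by
    rintro ⟨b, hb, hl, hr, u, h⟩
    exact corner_unitRegular_of_add he hff hsum hef hfe ha hb hl hr u h
  tfae_finish
end

section
/- Let R be a unit regular ring and e an idempotent in R. Then the corner ring eRe is a unit regular ring, i.e., every element of eRe is unit regular in eRe. -/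
/-- If the lower-right Peirce block `(1 - e) * u * (1 - e)` of a unit `u` is `1 - e`, then the
Schur complement of that block is a unit of the corner ring `eRe`, with inverse `e * u⁻¹ * e`. -/
lemma schurComplement_mul_corner {R : Type*} [Ring R] {e f u v : R}
    (he : e * e = e) (hef : e + f = 1) (huv : u * v = 1) (hfuf : f * u * f = f) :
    (e * u * e - e * u * f * u * e) * (e * v * e) = e := by
  obtain rfl : f = 1 - e := eq_sub_of_add_eq' hef
  have h₁ : e * u * e * v * e = e - e * u * (1 - e) * v * e := by
    calc e * u * e * v * e = e * (u * v) * e - e * u * (1 - e) * v * e := by noncomm_ring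
      _ = _ := by rw [huv, mul_one, he]
  have h₂ : (1 - e) * u * e * v * e = -((1 - e) * v * e) := by
    calc (1 - e) * u * e * v * e
        = (1 - e) * (u * v) * e - (1 - e) * u * (1 - e) * v * e := by noncomm_ring
      _ = _ := by rw [huv, hfuf, mul_one, sub_mul 1 e e, one_mul, he, sub_self, zero_sub]
  calc (e * u * e - e * u * (1 - e) * u * e) * (e * v * e)
      = e * u * (e * e) * v * e - e * u * ((1 - e) * u * (e * e) * v * e) := by noncomm_ring
    _ = e := by rw [he, h₁, h₂]; noncomm_ring

/-- The right-handed version of `schurComplement_mul_corner`. -/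
lemma corner_mul_schurComplement {R : Type*} [Ring R] {e f u v : R}
    (he : e * e = e) (hef : e + f = 1) (hvu : v * u = 1) (hfuf : f * u * f = f) :
    (e * v * e) * (e * u * e - e * u * f * u * e) = e := by
  have h := schurComplement_mul_corner (R := Rᵐᵒᵖ) (e := .op e) (f := .op f) (u := .op u)
    (v := .op v) (by simp [← MulOpposite.op_mul, he]) (by simp [← MulOpposite.op_add, hef])
    (by simp [← MulOpposite.op_mul, hvu]) (by simp [← MulOpposite.op_mul, ← mul_assoc, hfuf])
  simpa [mul_assoc] using congrArg MulOpposite.unop h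

/-- A corner ring of a unit regular ring is unit regular. -/
theorem corner_ring_unitRegular {R : Type*} [Ring R]
    (hR : ∀ a : R, ∃ u : Rˣ, a = a * u * a)
    (e : R) (he : e * e = e) :
    ∀ a : R, a = e * a * e →
      ∃ w : R, w = e * w * e ∧
        (∃ y : R, y = e * y * e ∧ w * y = e ∧ y * w = e) ∧ a = a * w * a := by
  intro a ha
  obtain ⟨f, hf⟩ : ∃ f, f = 1 - e := ⟨_, rfl⟩
  have hef : e + f = 1 := by rw [hf]; abel
  have hff : f * f = f := by simp [hf, mul_sub, sub_mul, he]
  have hea : e * a = a := by rw [ha]; simp only [← mul_assoc, he]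
  have hae : a * e = a := by rw [ha]; simp only [mul_assoc, he]
  have hfa : f * a = 0 := by rw [hf, sub_mul, one_mul, hea, sub_self]
  have haf : a * f = 0 := by rw [hf, mul_sub, mul_one, hae, sub_self]
  have hfe : f * e = 0 := by rw [hf, sub_mul, one_mul, he, sub_self]
  have hef0 : e * f = 0 := by rw [hf, mul_sub, mul_one, he, sub_self]
  obtain ⟨u, hu⟩ := hR (a + f)
  have block (p q : R) : p * (a + f) * q = (p * (a + f)) * u * ((a + f) * q) := by
    conv_lhs => rw [hu]
    simp only [mul_assoc]
  have haua : a = a * u * a := by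
    simpa [mul_add, add_mul, hea, hae, hef0, hfe] using block e e
  have hauf : a * u * f = 0 := by
    simpa [mul_add, add_mul, hea, haf, hef0, hff] using (block e f).symm
  have hfuf : f * u * f = f := by
    simpa [mul_add, add_mul, hfa, haf, hff] using (block f f).symm
  refine ⟨e * u * e - e * u * f * u * e, ?_, ⟨e * ↑u⁻¹ * e, ?_,
    schurComplement_mul_corner he hef u.mul_inv hfuf,
    corner_mul_schurComplement he hef u.inv_mul hfuf⟩, ?_⟩
  · simp only [mul_sub, sub_mul, ← mul_assoc, he]
    simp only [mul_assoc, he]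
  · simp only [← mul_assoc, he]
    simp only [mul_assoc, he]
  · calc a = a * u * a - a * u * f * u * a := by rw [hauf, ← haua]; simp
      _ = (a * e) * u * (e * a) - (a * e) * u * f * u * (e * a) := by rw [hae, hea]
      _ = _ := by noncomm_ring
end

section
/- Let R be a ring, e an idempotent in R, f = 1 − e, and a ∈ eRe. Suppose there exists b ∈ fRf that is not a right zero-divisor of the corner ring fRf, such that a + b is right unit regular in R (that is, a + b = (a+b)·u·(a+b) for some right-invertible element u of R). Then a is right unit regular in the corner ring eRe (that is, a = a·w·a for some w ∈ eRe that has a right inverse in eRe with respect to the identity e). -/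
/-- If `a + b` is right unit regular in `R` for some `b ∈ fRf` which is not a right
zero-divisor of `fRf` (where `f = 1 - e`), then `a` is right unit regular in the corner
ring `eRe`. -/
theorem corner_rightUnitRegular_of_add {R : Type*} [Ring R] (e f a b : R)
    (he : e * e = e) (hf : f = 1 - e) (ha : a = e * a * e) (hb : b = f * b * f)
    (hbz : ¬(∃ c : R, c = f * c * f ∧ c ≠ 0 ∧ c * b = 0))
    (h : ∃ u v : R, u * v = 1 ∧ a + b = (a + b) * u * (a + b)) :
    ∃ w : R, w = e * w * e ∧ (∃ y : R, y = e * y * e ∧ w * y = e) ∧ a = a * w * a := by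
  obtain ⟨u, v, huv, hu⟩ := h
  have he' : ∀ x, e * (e * x) = e * x := fun x => by rw [← mul_assoc, he]
  have hef : e * f = 0 := by rw [hf, mul_sub, he, mul_one, sub_self]
  have hfe : f * e = 0 := by rw [hf, sub_mul, he, one_mul, sub_self]
  have hff : f * f = f := by nth_rw 1 [hf]; rw [sub_mul, hef, one_mul, sub_zero]
  have hea : e * a = a := by rw [ha, mul_assoc, he']
  have hae : a * e = a := by rw [ha, mul_assoc, he]
  have hfb : f * b = b := by rw [hb, ← mul_assoc, ← mul_assoc, hff]
  have hbf : b * f = b := by rw [hb, mul_assoc, hff]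
  have hfa : f * a = 0 := by rw [← hea, ← mul_assoc, hfe, zero_mul]
  have haf : a * f = 0 := by rw [← hae, mul_assoc, hef, mul_zero]
  have heb : e * b = 0 := by rw [← hfb, ← mul_assoc, hef, zero_mul]
  have hbe : b * e = 0 := by rw [← hbf, mul_assoc, hfe, mul_zero]
  -- The diagonal and upper right entries of the Peirce decomposition of `hu`.
  have block : ∀ x y : R, x * (a + b) * y = (x * (a + b)) * u * ((a + b) * y) := fun x y => by
    conv_lhs => rw [hu]
    simp only [mul_assoc]
  have haua : a = a * u * a := by
    simpa only [mul_add, add_mul, hea, heb, hae, hbe, add_zero] using block e e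
  have haub : 0 = a * u * b := by
    simpa only [mul_add, add_mul, hea, heb, haf, hbf, add_zero, zero_add] using block e f
  have hbub : b = b * u * b := by
    simpa only [mul_add, add_mul, hfa, hfb, haf, hbf, zero_add] using block f f
  have hbuf : b * u * f = f := by
    by_contra hne
    refine hbz ⟨b * u * f - f, ?_, sub_ne_zero.mpr hne, ?_⟩
    · rw [mul_sub, sub_mul, hff, hff, ← mul_assoc, ← mul_assoc, hfb, mul_assoc _ f f, hff]
    · rw [sub_mul, mul_assoc _ f b, hfb, ← hbub, sub_self]
  have hbuev : b * u * e * v * e = -(f * v * e) := by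
    have he1 : e = 1 - f := by rw [hf, sub_sub_cancel]
    calc b * u * e * v * e = b * u * (1 - f) * v * e := by rw [← he1]
      _ = b * (u * v) * e - b * u * f * v * e := by noncomm_ring
      _ = -(f * v * e) := by rw [huv, mul_one, hbe, hbuf, zero_sub]
  -- The Schur complement of the lower right corner of `u`, with `b` as left inverse there.
  refine ⟨e * (u - u * b * u) * e, ?_, ⟨e * v * e, ?_, ?_⟩, ?_⟩
  · simp only [mul_assoc, he, he']
  · simp only [mul_assoc, he, he']
  · calc e * (u - u * b * u) * e * (e * v * e)
        = e * u * (e * e) * v * e - e * u * (b * u * (e * e) * v * e) := by noncomm_ring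
      _ = e * u * (e + f) * v * e := by rw [he, hbuev]; noncomm_ring
      _ = e * (u * v) * e := by rw [hf, add_sub_cancel, mul_one, mul_assoc e u v]
      _ = e := by rw [huv, mul_one, he]
  · calc a = a * u * a - a * u * b * u * a := by
          rw [← haub, zero_mul, zero_mul, sub_zero, ← haua]
      _ = (a * e) * (u - u * b * u) * (e * a) := by rw [hae, hea]; noncomm_ring
      _ = a * (e * (u - u * b * u) * e) * a := by simp only [mul_assoc]
end

section
/- Let R be a ring, e an idempotent in R, f = 1 − e, and a ∈ eRe. Suppose there exist b ∈ fRf, neither a left zero-divisor nor a right zero-divisor of the corner ring fRf, and elements u, v ∈ R such that a + b = (a+b)·u·(a+b), u·v·e = e, and e·v·u = e. Then a is unit regular in the corner ring eRe. -/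
/-- Remark (C): if `a + b = (a+b)·u·(a+b)` where `b ∈ fRf` is neither a left nor a right
zero-divisor of `fRf`, and `v ∈ R` satisfies `u·v·e = e` and `e·v·u = e`, then `a` is
unit regular in the corner ring `eRe`. -/
theorem corner_unitRegular_of_weak_inverse {R : Type*} [Ring R] (e f a b u v : R)
    (he : e * e = e) (hf : f = 1 - e) (ha : a = e * a * e) (hb : b = f * b * f)
    (hbl : ¬(∃ c : R, c = f * c * f ∧ c ≠ 0 ∧ b * c = 0))
    (hbr : ¬(∃ c : R, c = f * c * f ∧ c ≠ 0 ∧ c * b = 0))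
    (hreg : a + b = (a + b) * u * (a + b))
    (huv : u * v * e = e) (hvu : e * v * u = e) :
    ∃ w : R, w = e * w * e ∧
      (∃ y : R, y = e * y * e ∧ w * y = e ∧ y * w = e) ∧ a = a * w * a := by
  have hfe : f * e = 0 := by rw [hf, sub_mul, one_mul, he, sub_self]
  have hef : e * f = 0 := by rw [hf, mul_sub, mul_one, he, sub_self]
  have hff : f * f = f := by
    rw [hf] at hfe ⊢
    rw [mul_sub, mul_one, hfe, sub_zero]
  have hea : e * a = a := by rw [ha]; simp only [← mul_assoc, he]
  have hae : a * e = a := by rw [ha]; simp only [mul_assoc, he]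
  have hfb : f * b = b := by rw [hb]; simp only [← mul_assoc, hff]
  have hbf : b * f = b := by rw [hb]; simp only [mul_assoc, hff]
  have hfa : f * a = 0 := by rw [← hea, ← mul_assoc, hfe, zero_mul]
  have haf : a * f = 0 := by rw [← hae, mul_assoc, hef, mul_zero]
  have heb : e * b = 0 := by rw [← hfb, ← mul_assoc, hef, zero_mul]
  have hbe : b * e = 0 := by rw [← hbf, mul_assoc, hfe, mul_zero]
  -- Peirce components of the regularity equation
  have hl_e : a = a * u * (a + b) := by
    have h := congrArg (e * ·) hreg
    simpa only [← mul_assoc, mul_add e, hea, heb, add_zero] using h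
  have hl_f : b = b * u * (a + b) := by
    have h := congrArg (f * ·) hreg
    simpa only [← mul_assoc, mul_add f, hfa, hfb, zero_add] using h
  have haua : a * u * a = a := by
    have h := congrArg (· * e) hl_e
    simpa only [mul_assoc, add_mul, hae, hbe, add_zero] using h.symm
  have haub : a * u * b = 0 := by
    have h := congrArg (· * f) hl_e
    simpa only [mul_assoc, add_mul, haf, hbf, zero_add] using h.symm
  have hbub : b * u * b = b := by
    have h := congrArg (· * f) hl_f
    simpa only [mul_assoc, add_mul, haf, hbf, zero_add] using h.symm
  -- `f * u * f` is a two-sided inverse of `b` in the corner ring of `f`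
  have hfub : f * u * b = f := by
    by_contra hne
    refine hbl ⟨f * u * b - f, ?_, sub_ne_zero.2 hne, ?_⟩
    · simp only [mul_sub, sub_mul, mul_assoc, hff, hbf]
      simp only [← mul_assoc, hff]
    · rw [mul_sub, ← mul_assoc, ← mul_assoc, hbf, hbub, sub_self]
  have hbuf : b * u * f = f := by
    by_contra hne
    refine hbr ⟨b * u * f - f, ?_, sub_ne_zero.2 hne, ?_⟩
    · simp only [mul_sub, sub_mul, mul_assoc, hff]
      simp only [← mul_assoc, hfb]
    · rw [sub_mul, mul_assoc, hfb, hbub, sub_self]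
  have he1 : e = 1 - f := by rw [hf, sub_sub_cancel]
  have hue : u * e * v * e = e - u * f * v * e := by
    calc u * e * v * e = u * (1 - f) * v * e := by rw [← he1]
      _ = u * v * e - u * f * v * e := by simp only [mul_sub, sub_mul, mul_one]
      _ = e - u * f * v * e := by rw [huv]
  have hev : e * v * e * u = e - e * v * f * u := by
    calc e * v * e * u = e * v * (1 - f) * u := by rw [← he1]
      _ = e * v * u - e * v * f * u := by simp only [mul_sub, sub_mul, mul_one]
      _ = e - e * v * f * u := by rw [hvu]
  refine ⟨e * (u - u * b * u) * e, ?_, ⟨e * v * e, ?_, ?_, ?_⟩, ?_⟩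
  · simp only [mul_assoc, he]
    simp only [← mul_assoc, he]
  · simp only [mul_assoc, he]
    simp only [← mul_assoc, he]
  · calc e * (u - u * b * u) * e * (e * v * e)
        = e * (1 - u * b) * (u * (e * e) * v * e) := by noncomm_ring
      _ = e * (1 - u * b) * (e - u * f * v * e) := by rw [he, hue]
      _ = e * e - e * u * (b * e) - e * u * f * v * e
          + e * u * (b * u * f) * v * e := by noncomm_ring
      _ = e := by rw [he, hbe, hbuf]; noncomm_ring
  · calc e * v * e * (e * (u - u * b * u) * e)
        = (e * v * (e * e) * u) * (1 - b * u) * e := by noncomm_ring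
      _ = (e - e * v * f * u) * (1 - b * u) * e := by rw [he, hev]
      _ = e * e - (e * b) * u * e - e * v * f * u * e
          + e * v * (f * u * b) * u * e := by noncomm_ring
      _ = e := by rw [he, heb, hfub]; noncomm_ring
  · calc a = a * u * a - a * u * b * u * a := by rw [haub, haua]; simp
      _ = (a * e) * (u - u * b * u) * (e * a) := by rw [hae, hea]; noncomm_ring
      _ = a * (e * (u - u * b * u) * e) * a := by noncomm_ring
end

section
/- Let R be a ring, e an idempotent in R, f = 1 − e, and b ∈ fRf an element that is not a right zero-divisor of the corner ring fRf. If u ∈ R satisfies b = b·u·b, then (1 − b·u)·f = 0; equivalently, 1 − b·u = (1 − b·u)·e. -/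
/-- If `b ∈ fRf` is not a right zero-divisor of `fRf` and `b = b·u·b`, then
`(1 - b·u)·f = 0`, equivalently `1 - b·u = (1 - b·u)·e`. -/
theorem one_sub_bu_mul_f_eq_zero {R : Type*} [Ring R] (e f b u : R)
    (he : e * e = e) (hf : f = 1 - e) (hb : b = f * b * f)
    (hbz : ¬(∃ c : R, c = f * c * f ∧ c ≠ 0 ∧ c * b = 0))
    (h : b = b * u * b) :
    (1 - b * u) * f = 0 ∧ 1 - b * u = (1 - b * u) * e := by
  have hff : f * f = f := by
    subst hf
    simp [mul_sub, sub_mul, he]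
  have hfb : f * b = b := by
    rw [hb]
    simp only [← mul_assoc, hff]
  have hzero : (1 - b * u) * f = 0 := by
    by_contra hne
    refine hbz ⟨(1 - b * u) * f, ?_, hne, ?_⟩
    · simp only [sub_mul, mul_sub, one_mul, ← mul_assoc, hff, hfb]
      simp only [mul_assoc, hff]
    · rw [mul_assoc, hfb, sub_mul, one_mul, ← h, sub_self]
  refine ⟨hzero, ?_⟩
  rw [hf, mul_sub, mul_one] at hzero
  exact sub_eq_zero.mp hzero
end

section
/- Let R be a ring, e an idempotent in R, f = 1 − e, and b ∈ fRf an element that is not a left zero-divisor of the corner ring fRf. If u ∈ R satisfies b = b·u·b, then e·(1 − u·b) = 1 − u·b. -/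
/-- If `b ∈ fRf` is not a left zero-divisor of `fRf` and `b = b·u·b`, then
`e·(1 - u·b) = 1 - u·b`. -/
theorem e_mul_one_sub_ub {R : Type*} [Ring R] (e f b u : R)
    (he : e * e = e) (hf : f = 1 - e) (hb : b = f * b * f)
    (hbz : ¬(∃ c : R, c = f * c * f ∧ c ≠ 0 ∧ b * c = 0))
    (h : b = b * u * b) :
    e * (1 - u * b) = 1 - u * b := by
  have hff : f * f = f := hf ▸ IsIdempotentElem.one_sub he
  have hbf : b * f = b := by rw [hb, mul_assoc, hff]
  have hc : f - f * u * b = 0 := by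
    by_contra hne
    refine hbz ⟨f - f * u * b, ?_, hne, ?_⟩
    · rw [mul_sub, sub_mul, hff, hff, ← mul_assoc, ← mul_assoc, hff, mul_assoc _ b f, hbf]
    · rw [mul_sub, ← mul_assoc, ← mul_assoc, hbf, ← h, sub_self]
  have hfe : f * (1 - u * b) = 0 := by rwa [mul_sub, mul_one, ← mul_assoc]
  rw [hf, sub_mul, one_mul, sub_eq_zero] at hfe
  exact hfe.symm
end

section
/- Let S be a ring and s, t ∈ S with s = s·t·s. In the matrix ring M₂(S), the matrix u with first row (t, 1) and second row (1, 0) is a unit, with inverse the matrix with first row (0, 1) and second row (1, −t), and the matrix a with first row (s, 0) and second row (0, 0) satisfies a = a·u·a; hence every von Neumann regular element s of S yields a unit regular element diag(s, 0) of M₂(S). -/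
open Matrix

/-- In `M₂(S)`, the matrix `u = !![t, 1; 1, 0]` is a unit with inverse `!![0, 1; 1, -t]`,
and if `s = s·t·s` then `a = !![s, 0; 0, 0]` satisfies `a = a·u·a`; hence `a` is unit
regular in `M₂(S)`. -/
theorem regular_elt_gives_unitRegular_matrix {S : Type*} [Ring S] (s t : S)
    (hst : s = s * t * s) :
    (!![t, 1; 1, 0] : Matrix (Fin 2) (Fin 2) S) * !![0, 1; 1, -t] = 1 ∧
    (!![0, 1; 1, -t] : Matrix (Fin 2) (Fin 2) S) * !![t, 1; 1, 0] = 1 ∧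
    (!![s, 0; 0, 0] : Matrix (Fin 2) (Fin 2) S) =
      !![s, 0; 0, 0] * !![t, 1; 1, 0] * !![s, 0; 0, 0] ∧
    ∃ u : (Matrix (Fin 2) (Fin 2) S)ˣ,
      (!![s, 0; 0, 0] : Matrix (Fin 2) (Fin 2) S) = !![s, 0; 0, 0] * u.val * !![s, 0; 0, 0] := by
  have h₁ : (!![t, 1; 1, 0] : Matrix (Fin 2) (Fin 2) S) * !![0, 1; 1, -t] = 1 := by
    simp [Matrix.one_fin_two]
  have h₂ : (!![0, 1; 1, -t] : Matrix (Fin 2) (Fin 2) S) * !![t, 1; 1, 0] = 1 := by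
    simp [Matrix.one_fin_two]
  have h₃ : (!![s, 0; 0, 0] : Matrix (Fin 2) (Fin 2) S) =
      !![s, 0; 0, 0] * !![t, 1; 1, 0] * !![s, 0; 0, 0] := by
    simp [← hst]
  exact ⟨h₁, h₂, h₃, ⟨_, _, h₁, h₂⟩, h₃⟩
end

section
/- Let S be a ring containing an element s that is von Neumann regular in S (i.e., s = s·t·s for some t ∈ S) but not unit regular in S. Let R = M₂(S), let e ∈ R be the idempotent matrix with first row (1, 0) and second row (0, 0), and let a ∈ eRe be the matrix with first row (s, 0) and second row (0, 0). Then a is unit regular in R, but a is not unit regular in the corner ring eRe. -/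
open Matrix

/-- If `s ∈ S` is von Neumann regular but not unit regular, then in `R = M₂(S)`, with
idempotent `e = !![1, 0; 0, 0]`, the element `a = !![s, 0; 0, 0] ∈ eRe` is unit regular
in `R` but not unit regular in the corner ring `eRe`. -/
theorem counterexample_converse {S : Type*} [Ring S] (s : S)
    (hreg : ∃ t : S, s = s * t * s)
    (hnur : ¬ ∃ u : Sˣ, s = s * u * s) :
    (∃ u : (Matrix (Fin 2) (Fin 2) S)ˣ,
      (!![s, 0; 0, 0] : Matrix (Fin 2) (Fin 2) S) = !![s, 0; 0, 0] * u.val * !![s, 0; 0, 0]) ∧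
    ¬ ∃ w : Matrix (Fin 2) (Fin 2) S,
        w = !![(1 : S), 0; 0, 0] * w * !![(1 : S), 0; 0, 0] ∧
        (∃ y : Matrix (Fin 2) (Fin 2) S,
          y = !![(1 : S), 0; 0, 0] * y * !![(1 : S), 0; 0, 0] ∧
          w * y = !![(1 : S), 0; 0, 0] ∧ y * w = !![(1 : S), 0; 0, 0]) ∧
        (!![s, 0; 0, 0] : Matrix (Fin 2) (Fin 2) S) =
          !![s, 0; 0, 0] * w * !![s, 0; 0, 0] := by
  constructor
  · obtain ⟨t, ht⟩ := hreg
    refine ⟨⟨!![t, 1; 1, 0], !![0, 1; 1, -t], ?_, ?_⟩, ?_⟩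
    · simp [Matrix.one_fin_two]
    · simp [Matrix.one_fin_two]
    · simp [← ht]
  · rintro ⟨w, hw, ⟨y, hy, hwy, hyw⟩, hs⟩
    have hw01 : w 0 1 = 0 := by
      rw [hw]
      simp [Matrix.mul_apply, Fin.sum_univ_two]
    have hy01 : y 0 1 = 0 := by
      rw [hy]
      simp [Matrix.mul_apply, Fin.sum_univ_two]
    have hwy00 := congrFun (congrFun hwy 0) 0
    have hyw00 := congrFun (congrFun hyw 0) 0
    have hs00 := congrFun (congrFun hs 0) 0
    simp only [Matrix.mul_apply, Fin.sum_univ_two, hw01, hy01] at hwy00 hyw00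
    refine hnur ⟨⟨w 0 0, y 0 0, by simpa using hwy00, by simpa using hyw00⟩, ?_⟩
    simp only [Matrix.mul_apply, Fin.sum_univ_two] at hs00
    simpa using hs00
end

section
/- Let R be a ring in which every element is right unit regular (that is, for every a ∈ R there is a right-invertible u ∈ R with a = a·u·a), and let e be an idempotent in R. Then every element of the corner ring eRe is right unit regular in eRe (that is, for every a ∈ eRe there is w ∈ eRe admitting a right inverse in eRe with a = a·w·a). -/
/-- If every element of `R` is right unit regular, then every element of the corner ring
`eRe` is right unit regular in `eRe`. -/
theorem corner_ring_rightUnitRegular {R : Type*} [Ring R]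
    (hR : ∀ a : R, ∃ u v : R, u * v = 1 ∧ a = a * u * a)
    (e : R) (he : e * e = e) :
    ∀ a : R, a = e * a * e →
      ∃ w : R, w = e * w * e ∧ (∃ y : R, y = e * y * e ∧ w * y = e) ∧ a = a * w * a := by
  intro a ha
  have hea : e * a = a := by rw [ha, ← mul_assoc, ← mul_assoc, he]
  have hae : a * e = a := by rw [ha, mul_assoc, he]
  obtain ⟨f, hf⟩ : ∃ f, f = 1 - e := ⟨_, rfl⟩
  have hef : e * f = 0 := by rw [hf, mul_sub, he, mul_one, sub_self]
  have hfe : f * e = 0 := by rw [hf, sub_mul, he, one_mul, sub_self]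
  have hff : f * f = f := by nth_rw 1 [hf]; rw [sub_mul, hef, one_mul, sub_zero]
  have hfa : f * a = 0 := by rw [← hea, ← mul_assoc, hfe, zero_mul]
  have haf : a * f = 0 := by rw [← hae, mul_assoc, hef, mul_zero]
  obtain ⟨u, v, huv, hb⟩ := hR (a + f)
  have hfb : f * (a + f) = f := by rw [mul_add, hfa, hff, zero_add]
  have hbf : (a + f) * f = f := by rw [add_mul, haf, hff, zero_add]
  have heb : e * (a + f) = a := by rw [mul_add, hea, hef, add_zero]
  have hbe : (a + f) * e = a := by rw [add_mul, hae, hfe, add_zero]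
  -- The blocks of `(a + f) * u * (a + f) = a + f`.
  have block (p q : R) : p * (a + f) * q = p * (a + f) * u * ((a + f) * q) := by
    nth_rw 1 [hb]
    simp only [mul_assoc]
  have hfuf : f * u * f = f := by
    have := block f f
    rwa [hfb, hbf, hff, eq_comm] at this
  have haua : a * u * a = a := by
    have := block e e
    rwa [heb, hbe, hae, eq_comm] at this
  have hauf : a * u * f = 0 := by
    have := block e f
    rwa [heb, hbf, haf, eq_comm] at this
  have heq : e = 1 - f := by rw [hf, sub_sub_cancel]
  have huev : u * e * v = 1 - u * f * v := by
    rw [heq, mul_sub, sub_mul, mul_one, huv]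
  refine ⟨e * u * e - e * u * f * u * e, ?_, ⟨e * v * e, ?_, ?_⟩, ?_⟩
  · simp only [mul_sub, sub_mul, mul_assoc, he]
    simp only [← mul_assoc, he]
  · simp only [mul_assoc, he]
    simp only [← mul_assoc, he]
  · calc (e * u * e - e * u * f * u * e) * (e * v * e)
        = e * (u * (e * e) * v) * e - e * u * f * (u * (e * e) * v) * e := by noncomm_ring
      _ = e * e - e * u * f * v * e - e * u * (f * e) + e * u * (f * u * f) * v * e := by
        rw [show u * (e * e) * v = 1 - u * f * v by rw [he, huev]]; noncomm_ring
      _ = e := by rw [he, hfe, hfuf]; noncomm_ring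
  · calc a = a * u * a - a * u * f * u * a := by rw [haua, hauf]; simp
      _ = (a * e) * u * (e * a) - (a * e) * u * f * u * (e * a) := by rw [hae, hea]
      _ = _ := by noncomm_ring
end
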